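/- Garsia-type bound for 2-increments: let V be a Banach space, g ∈ C_2([0,T];V), κ > 0 and p ≥ 1 with κ + 2/p replaced appropriately; then there exists a constant c (depending on κ, p, T) such that ‖g‖_κ ≤ c (U_{κ+2/p;p}(g) + ‖δg‖_κ), where U_{γ;p}(g) = (∫_0^T ∫_0^T |g_{st}|^p / |t−s|^{γp} ds dt)^{1/p} and ‖δg‖_κ = sup_{s,u,t} |(δg)_{sut}| / |t−s|^κ (with the convention that the right-hand side may be +∞). -/

import Mathlib

open MeasureTheory

lemma gtb_seq (a : ℕ → ℝ) (K ρ : ℝ) (hK : 0 ≤ K) (hρ0 : 0 ≤ ρ) (hρ : ρ < 1)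
    (h : ∀ n, a n ≤ a (n+1) + K * ρ ^ n) (h0 : ∀ ε > 0, ∃ n, a n ≤ ε) :
    a 0 ≤ K / (1 - ρ) := by
  have h1 : ∀ n, a 0 ≤ a n + K * (1 - ρ ^ n) / (1 - ρ) := by
    intro n
    induction n with
    | zero => simp
    | succ n ih =>
      have : K * (1 - ρ ^ (n+1)) / (1 - ρ) = K * ρ ^ n + K * (1 - ρ ^ n) / (1 - ρ) := by
        have : 1 - ρ ≠ 0 := by linarith
        field_simp
        ring
      have := h n
      linarith
  refine le_of_forall_pos_le_add fun ε hε => ?_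
  obtain ⟨n, hn⟩ := h0 ε hε
  have h2 : K * (1 - ρ ^ n) / (1 - ρ) ≤ K / (1 - ρ) := by
    have : 0 ≤ ρ ^ n := by positivity
    apply div_le_div_of_nonneg_right _ (by linarith)
    nlinarith
  linarith [h1 n]

lemma gtb_rect {V : Type*} [NormedAddCommGroup V] [NormedSpace ℝ V]
    (T κ q : ℝ) (hκ : 0 < κ) (hq : 1 ≤ q) (g : ℝ → ℝ → V) (hg : ∀ s, g s s = 0)
    (hc : ContinuousOn (fun p : ℝ × ℝ => g p.1 p.2) (Set.Icc 0 T ×ˢ Set.Icc 0 T))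
    (hi : IntegrableOn (fun p : ℝ × ℝ => ‖g p.1 p.2‖ ^ q / |p.2 - p.1| ^ ((κ + 2 / q) * q))
          (Set.Icc 0 T ×ˢ Set.Icc 0 T))
    (l l' h : ℝ) (hh : 0 < h) (h1 : Set.Icc l (l + h) ⊆ Set.Icc 0 T)
    (h2 : Set.Icc l' (l' + h/2) ⊆ Set.Icc l (l + h)) :
    ∫ p in Set.Icc l' (l' + h/2) ×ˢ Set.Icc l (l + h), ‖g p.1 p.2‖ ≤
      (h/2 * h) * (2 * (∫ p in Set.Icc (0:ℝ) T ×ˢ Set.Icc (0:ℝ) T,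
              ‖g p.1 p.2‖ ^ q / |p.2 - p.1| ^ ((κ + 2 / q) * q)) ^ (1 / q) * h ^ κ) := by
  set R := Set.Icc l' (l' + h/2) ×ˢ Set.Icc l (l + h) with hR
  set Q := Set.Icc (0:ℝ) T ×ˢ Set.Icc (0:ℝ) T
  set G := fun p : ℝ × ℝ => ‖g p.1 p.2‖ ^ q / |p.2 - p.1| ^ ((κ + 2 / q) * q) with hG
  have hq0 : 0 < q := by linarith
  have hRQ : R ⊆ Q := Set.prod_mono (h2.trans h1) h1
  have hRc : IsCompact R := isCompact_Icc.prod isCompact_Icc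
  have hRm : MeasurableSet R := hRc.measurableSet
  have hvol : volume.real R = h/2 * h := by
    rw [hR, Measure.volume_eq_prod, measureReal_prod_prod]
    simp [Real.volume_real_Icc, hh.le, (half_pos hh).le]
  have hG0 : ∀ p, 0 ≤ G p := fun p => by simp only [hG]; positivity
  have hcR : ContinuousOn (fun p : ℝ × ℝ => ‖g p.1 p.2‖) R := (hc.mono hRQ).norm
  have hcRq : ContinuousOn (fun p : ℝ × ℝ => ‖g p.1 p.2‖ ^ q) R :=
    hcR.rpow_const fun _ _ => Or.inr hq0.le
  have hiR := hcR.integrableOn_compact (μ := volume) hRc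
  have hiRq := hcRq.integrableOn_compact (μ := volume) hRc
  have hexp : (κ + 2/q) * q = κ * q + 2 := by field_simp
  have hpt : ∀ p ∈ R, ‖g p.1 p.2‖ ^ q ≤ h ^ (κ * q + 2) * G p := by
    rintro ⟨r, t⟩ ⟨hr, ht⟩
    simp only [hG]
    rw [hexp]
    by_cases hrt : r = t
    · subst hrt
      simp only [hg, norm_zero, Real.zero_rpow hq0.ne']
      simp
    · have hpos : 0 < |t - r| := abs_pos.mpr (sub_ne_zero.mpr (Ne.symm hrt))
      have hle : |t - r| ≤ h := by
        have := h2 hr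
        simp only [Set.mem_Icc] at this ht
        rw [abs_le]; constructor <;> linarith
      have hple : |t - r| ^ (κ * q + 2) ≤ h ^ (κ * q + 2) :=
        Real.rpow_le_rpow hpos.le hle (by positivity)
      have hpp : 0 < |t - r| ^ (κ * q + 2) := by positivity
      rw [← mul_div_assoc, le_div_iff₀ hpp, mul_comm]
      exact mul_le_mul_of_nonneg_right hple (by positivity)
  set I := ∫ p in Q, G p with hI
  have hI0 : 0 ≤ I := integral_nonneg hG0
  have hint : ∫ p in R, ‖g p.1 p.2‖ ^ q ≤ h ^ (κ * q + 2) * I := by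
    calc ∫ p in R, ‖g p.1 p.2‖ ^ q ≤ ∫ p in R, h ^ (κ * q + 2) * G p :=
          setIntegral_mono_on hiRq ((hi.mono_set hRQ).const_mul _) hRm hpt
      _ = h ^ (κ * q + 2) * ∫ p in R, G p := integral_const_mul _ _
      _ ≤ _ := by
          apply mul_le_mul_of_nonneg_left _ (by positivity)
          exact setIntegral_mono_set hi (Filter.Eventually.of_forall hG0) hRQ.eventuallyLE
  have hv0 : volume R ≠ 0 := by
    intro h0
    have : volume.real R = 0 := by simp [Measure.real, h0]
    rw [hvol] at this
    have : 0 < h/2*h := by positivity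
    linarith
  have hJ := (convexOn_rpow hq).map_set_average_le
    (Real.continuous_rpow_const hq0.le).continuousOn isClosed_Ici hv0 hRc.measure_lt_top.ne
    (f := fun p : ℝ × ℝ => ‖g p.1 p.2‖)
    (Filter.Eventually.of_forall fun p => norm_nonneg _) hiR hiRq
  simp only [setAverage_eq, hvol, smul_eq_mul] at hJ
  set A := ∫ p in R, ‖g p.1 p.2‖ with hA
  have hA0 : 0 ≤ A := integral_nonneg fun p => norm_nonneg _
  have hB : ((h/2*h)⁻¹ * A) ^ q ≤ (2 * I ^ (1/q) * h ^ κ) ^ q := by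
    calc ((h/2*h)⁻¹ * A) ^ q ≤ (h/2*h)⁻¹ * (h ^ (κ * q + 2) * I) :=
          hJ.trans (mul_le_mul_of_nonneg_left hint (by positivity))
      _ = 2 * (I * h ^ (κ * q)) := by
          rw [Real.rpow_add hh, Real.rpow_two]; field_simp
      _ ≤ 2 ^ q * (I * h ^ (κ * q)) := by
          apply mul_le_mul_of_nonneg_right _ (by positivity)
          calc (2:ℝ) = 2 ^ (1:ℝ) := by simp
            _ ≤ 2 ^ q := Real.rpow_le_rpow_of_exponent_le (by norm_num) hq
      _ = _ := by
          rw [Real.mul_rpow (by positivity) (by positivity),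
            Real.mul_rpow (by positivity) (by positivity), ← Real.rpow_mul hI0,
            ← Real.rpow_mul hh.le, one_div_mul_cancel hq0.ne', Real.rpow_one]; ring
  have hD := (Real.rpow_le_rpow_iff (by positivity) (by positivity) hq0).1 hB
  rwa [inv_mul_le_iff₀ (by positivity)] at hD

lemma gtb_side {V : Type*} [NormedAddCommGroup V] [NormedSpace ℝ V]
    (T κ q : ℝ) (hκ : 0 < κ) (hq : 1 ≤ q) (g : ℝ → ℝ → V) (hg : ∀ s, g s s = 0)
    (hc : ContinuousOn (fun p : ℝ × ℝ => g p.1 p.2) (Set.Icc 0 T ×ˢ Set.Icc 0 T))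
    (C : ℝ) (hC : 0 ≤ C)
    (hd : ∀ s ∈ Set.Icc (0:ℝ) T, ∀ u ∈ Set.Icc (0:ℝ) T, ∀ v ∈ Set.Icc (0:ℝ) T,
          ‖g s v - g s u - g u v‖ ≤ C * |v - s| ^ κ)
    (hi : IntegrableOn (fun p : ℝ × ℝ => ‖g p.1 p.2‖ ^ q / |p.2 - p.1| ^ ((κ + 2 / q) * q))
          (Set.Icc 0 T ×ˢ Set.Icc 0 T))
    (s d : ℝ) (hd0 : 0 < d) (l : ℕ → ℝ)
    (hl : ∀ n, s ∈ Set.Icc (l n) (l n + d / 2 ^ n))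
    (hm : ∀ n, Set.Icc (l (n+1)) (l (n+1) + d / 2 ^ (n+1)) ⊆ Set.Icc (l n) (l n + d / 2 ^ n))
    (h0 : ∀ n, Set.Icc (l n) (l n + d / 2 ^ n) ⊆ Set.Icc 0 T) :
    ∫ t in Set.Icc (l 0) (l 0 + d), ‖g s t‖ ≤
      d * ((2 * (∫ p in Set.Icc (0:ℝ) T ×ˢ Set.Icc (0:ℝ) T,
              ‖g p.1 p.2‖ ^ q / |p.2 - p.1| ^ ((κ + 2 / q) * q)) ^ (1 / q) + C) * d ^ κ
              / (1 - (1/2) ^ κ)) := by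
  set U := (∫ p in Set.Icc (0:ℝ) T ×ˢ Set.Icc (0:ℝ) T,
              ‖g p.1 p.2‖ ^ q / |p.2 - p.1| ^ ((κ + 2 / q) * q)) ^ (1 / q) with hU
  have hU0 : 0 ≤ U := Real.rpow_nonneg (integral_nonneg fun p => by positivity) _
  have hsT : s ∈ Set.Icc 0 T := h0 0 (hl 0)
  have hcs : ContinuousOn (fun t => ‖g s t‖) (Set.Icc 0 T) := by
    have : ContinuousOn (fun t => g s t) (Set.Icc 0 T) :=
      hc.comp (f := fun t => (s, t)) (by fun_prop) (fun t ht => ⟨hsT, ht⟩)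
    exact this.norm
  have hhp : ∀ n : ℕ, 0 < d / 2 ^ n := fun n => by positivity
  have hvn : ∀ n, volume.real (Set.Icc (l n) (l n + d / 2 ^ n)) = d / 2 ^ n := fun n => by
    simp [Real.volume_real_Icc, (hhp n).le]
  have hin : ∀ n, IntegrableOn (fun t => ‖g s t‖) (Set.Icc (l n) (l n + d / 2 ^ n)) := fun n =>
    (hcs.mono (h0 n)).integrableOn_compact isCompact_Icc
  have key := gtb_seq (fun n => (d / 2 ^ n)⁻¹ * ∫ t in Set.Icc (l n) (l n + d / 2 ^ n), ‖g s t‖)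
    ((2 * U + C) * d ^ κ) ((1/2) ^ κ) (by positivity) (by positivity)
    (Real.rpow_lt_one (by norm_num) (by norm_num) hκ) ?_ ?_
  · simp only [pow_zero, div_one] at key
    rwa [inv_mul_le_iff₀ hd0] at key
  · intro n
    have hnext : d / 2 ^ (n+1) = d / 2 ^ n / 2 := by rw [pow_succ]; field_simp
    have hpw : d ^ κ * ((1/2:ℝ) ^ κ) ^ n = (d / 2 ^ n) ^ κ := by
      rw [← Real.rpow_natCast, ← Real.rpow_mul (by norm_num), mul_comm κ, Real.rpow_mul (by norm_num),
        ← Real.mul_rpow hd0.le (by positivity), Real.rpow_natCast]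
      congr 1
      field_simp
      simp
    rw [mul_assoc, hpw]
    have hmn := hm n
    have hvI := hvn (n+1)
    have hiI := hin (n+1)
    have h0I := h0 (n+1)
    simp only [hnext] at hmn hvI hiI h0I ⊢
    have hvJ := hvn n
    have hiJ := hin n
    have h0J := h0 n
    have hlJ := hl n
    have hh := hhp n
    clear_value U
    generalize d / 2 ^ n = h at *
    have hrect := gtb_rect T κ q hκ hq g hg hc hi (l n) (l (n+1)) h hh h0J hmn
    rw [← hU] at hrect
    set I := Set.Icc (l (n+1)) (l (n+1) + h/2) with hI
    set J := Set.Icc (l n) (l n + h) with hJ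
    have hIJm : MeasurableSet (I ×ˢ J) := measurableSet_Icc.prod measurableSet_Icc
    have hIJc : IsCompact (I ×ˢ J) := isCompact_Icc.prod isCompact_Icc
    have hQ : I ×ˢ J ⊆ Set.Icc 0 T ×ˢ Set.Icc 0 T := Set.prod_mono h0I h0J
    have i1 : IntegrableOn (fun p : ℝ × ℝ => ‖g s p.2‖) (I ×ˢ J) :=
      (hcs.comp continuous_snd.continuousOn (fun p hp => (hQ hp).2)).integrableOn_compact hIJc
    have i2 : IntegrableOn (fun p : ℝ × ℝ => ‖g s p.1‖) (I ×ˢ J) :=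
      (hcs.comp continuous_fst.continuousOn (fun p hp => (hQ hp).1)).integrableOn_compact hIJc
    have i3 : IntegrableOn (fun p : ℝ × ℝ => ‖g p.1 p.2‖) (I ×ˢ J) :=
      (hc.mono hQ).norm.integrableOn_compact hIJc
    have i4 : IntegrableOn (fun p : ℝ × ℝ => C * h ^ κ) (I ×ˢ J) :=
      continuousOn_const.integrableOn_compact hIJc
    have hmono : ∫ p in I ×ˢ J, ‖g s p.2‖ ≤
        ∫ p in I ×ˢ J, (‖g s p.1‖ + ‖g p.1 p.2‖ + C * h ^ κ) := by
      refine setIntegral_mono_on i1 ((i2.add i3).add i4) hIJm ?_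
      rintro ⟨r, t⟩ ⟨hr, ht⟩
      have e1 := hd s hsT r (h0I hr) t (h0J ht)
      have e2 : |t - s| ^ κ ≤ h ^ κ := by
        apply Real.rpow_le_rpow (abs_nonneg _) _ hκ.le
        simp only [hJ, Set.mem_Icc] at ht hlJ
        rw [abs_le]; constructor <;> linarith
      have e3 := mul_le_mul_of_nonneg_left e2 hC
      have e4 : g s t = (g s t - g s r - g r t) + g s r + g r t := by abel
      have e5 : ‖g s t‖ ≤ ‖g s t - g s r - g r t‖ + ‖g s r‖ + ‖g r t‖ := by
        conv_lhs => rw [e4]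
        exact norm_add₃_le
      simp only
      linarith
    have i23 : IntegrableOn (fun p : ℝ × ℝ => ‖g s p.1‖ + ‖g p.1 p.2‖) (I ×ˢ J) := i2.add i3
    rw [integral_add i23 i4, integral_add i2 i3] at hmono
    have f1 : ∫ p in I ×ˢ J, ‖g s p.2‖ = h/2 * ∫ t in J, ‖g s t‖ := by
      rw [Measure.volume_eq_prod]
      have := setIntegral_prod_mul (μ := (volume : Measure ℝ)) (ν := (volume : Measure ℝ))
        (fun _ : ℝ => (1:ℝ)) (fun t => ‖g s t‖) I J
      simpa [hvI] using this
    have f2 : ∫ p in I ×ˢ J, ‖g s p.1‖ = h * ∫ t in I, ‖g s t‖ := by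
      rw [Measure.volume_eq_prod]
      have := setIntegral_prod_mul (μ := (volume : Measure ℝ)) (ν := (volume : Measure ℝ))
        (fun t => ‖g s t‖) (fun _ : ℝ => (1:ℝ)) I J
      simpa [hvJ, mul_comm] using this
    have f3 : ∫ p in I ×ˢ J, C * h ^ κ = h/2 * h * (C * h ^ κ) := by
      rw [setIntegral_const, Measure.volume_eq_prod, measureReal_prod_prod, hvI, hvJ, smul_eq_mul]
    rw [f1, f2, f3] at hmono
    rw [inv_mul_le_iff₀ hh]
    have hfin : h/2 * ∫ t in J, ‖g s t‖ ≤ h/2 * (h * ((h/2)⁻¹ * (∫ t in I, ‖g s t‖) + (2 * U + C) * h ^ κ)) := by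
      have : h/2 * (h * ((h/2)⁻¹ * (∫ t in I, ‖g s t‖) + (2 * U + C) * h ^ κ)) =
        h * (∫ t in I, ‖g s t‖) + (h/2*h) * (2 * U * h ^ κ) + h/2 * h * (C * h ^ κ) := by
        field_simp
        ring
      rw [this]; linarith
    exact le_of_mul_le_mul_left hfin (by positivity)
  · intro ε hε
    have hcont := hcs s hsT
    have := Metric.continuousWithinAt_iff.1 hcont ε hε
    obtain ⟨δ, hδ, hδ'⟩ := this
    obtain ⟨n, hn⟩ := exists_pow_lt_of_lt_one (show 0 < δ / d by positivity) (show (1/2:ℝ) < 1 by norm_num)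
    have hn' : d / 2 ^ n < δ := by
      rw [lt_div_iff₀ hd0] at hn
      rw [one_div, inv_pow] at hn
      rw [div_eq_inv_mul]; exact hn
    refine ⟨n, ?_⟩
    rw [inv_mul_le_iff₀ (hhp n)]
    calc _ ≤ ∫ t in Set.Icc (l n) (l n + d / 2 ^ n), ε := by
          refine setIntegral_mono_on (hin n) (continuousOn_const.integrableOn_compact isCompact_Icc)
            measurableSet_Icc fun t ht => ?_
          have hs := hl n
          have := hδ' (h0 n ht) (by
            simp only [Set.mem_Icc] at ht hs
            rw [Real.dist_eq, abs_lt]; constructor <;> linarith)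
          rw [hg, norm_zero, Real.dist_eq, sub_zero, abs_of_nonneg (norm_nonneg _)] at this
          exact this.le
      _ = _ := by rw [setIntegral_const, hvn, smul_eq_mul]

/-- Garsia-type bound for 2-increments. For `κ > 0`, `q ≥ 1` and `T > 0`
there is a constant `c > 0` (depending only on `κ, q, T`) such that for any continuous
2-increment `g` on `[0,T]²` vanishing on the diagonal, with
`U = (∫∫_{[0,T]²} ‖g_{st}‖^q / |t−s|^{(κ+2/q)q} ds dt)^{1/q}` finite and
`‖(δg)_{sut}‖ ≤ C |t−s|^κ`, one has `‖g_{st}‖ ≤ c (U + C) |t−s|^κ`. -/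
theorem garsia_type_bound {V : Type*} [NormedAddCommGroup V] [NormedSpace ℝ V]
    (T κ q : ℝ) (hT : 0 < T) (hκ : 0 < κ) (hq : 1 ≤ q) :
    ∃ c : ℝ, 0 < c ∧
      ∀ g : ℝ → ℝ → V, (∀ s, g s s = 0) →
        ContinuousOn (fun p : ℝ × ℝ => g p.1 p.2) (Set.Icc 0 T ×ˢ Set.Icc 0 T) →
        ∀ C : ℝ, 0 ≤ C →
        (∀ s ∈ Set.Icc (0:ℝ) T, ∀ u ∈ Set.Icc (0:ℝ) T, ∀ v ∈ Set.Icc (0:ℝ) T,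
          ‖g s v - g s u - g u v‖ ≤ C * |v - s| ^ κ) →
        IntegrableOn (fun p : ℝ × ℝ => ‖g p.1 p.2‖ ^ q / |p.2 - p.1| ^ ((κ + 2 / q) * q))
          (Set.Icc 0 T ×ˢ Set.Icc 0 T) →
        ∀ s ∈ Set.Icc (0:ℝ) T, ∀ v ∈ Set.Icc (0:ℝ) T,
          ‖g s v‖ ≤ c * ((∫ p in Set.Icc (0:ℝ) T ×ˢ Set.Icc (0:ℝ) T,
              ‖g p.1 p.2‖ ^ q / |p.2 - p.1| ^ ((κ + 2 / q) * q)) ^ (1 / q) + C)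
            * |v - s| ^ κ := by
  have hρ : (1/2:ℝ) ^ κ < 1 := Real.rpow_lt_one (by norm_num) (by norm_num) hκ
  have hρ' : 0 < 1 - (1/2:ℝ) ^ κ := by linarith
  refine ⟨4 / (1 - (1/2) ^ κ) + 1, by positivity, ?_⟩
  intro g hg hc C hC hd hi
  have hanti : ∀ s ∈ Set.Icc (0:ℝ) T, ∀ v ∈ Set.Icc (0:ℝ) T, ‖g s v‖ = ‖g v s‖ := by
    intro s hs v hv
    have := hd s hs v hv s hs
    rw [hg, sub_self, abs_zero, Real.zero_rpow hκ.ne', mul_zero] at this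
    have := norm_le_zero_iff.1 this
    have e : g s v = - g v s := by
      rw [zero_sub, sub_eq_zero] at this
      rw [← this, neg_neg]
    rw [e, norm_neg]
  set U := (∫ p in Set.Icc (0:ℝ) T ×ˢ Set.Icc (0:ℝ) T,
              ‖g p.1 p.2‖ ^ q / |p.2 - p.1| ^ ((κ + 2 / q) * q)) ^ (1 / q) with hU
  have hU0 : 0 ≤ U := Real.rpow_nonneg (integral_nonneg fun p => by positivity) _
  have main : ∀ s ∈ Set.Icc (0:ℝ) T, ∀ v ∈ Set.Icc (0:ℝ) T, s < v →
      ‖g s v‖ ≤ (4 / (1 - (1/2) ^ κ) + 1) * (U + C) * |v - s| ^ κ := by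
    intro s hs v hv hsv
    have hd0 : 0 < v - s := by linarith
    have hle : ∀ n : ℕ, (v - s) / 2 ^ (n+1) ≤ (v - s) / 2 ^ n := fun n => by
      apply div_le_div_of_nonneg_left hd0.le (by positivity)
      exact pow_le_pow_right₀ (by norm_num) (Nat.le_succ n)
    have hle0 : ∀ n : ℕ, (v - s) / 2 ^ n ≤ v - s := fun n =>
      div_le_self hd0.le (one_le_pow₀ (by norm_num))
    have hps : ∀ n : ℕ, 0 < (v - s) / 2 ^ n := fun n => by positivity
    have A1 := gtb_side T κ q hκ hq g hg hc C hC hd hi s (v - s) hd0 (fun _ => s)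
      (fun n => ⟨le_rfl, by linarith [hps n]⟩)
      (fun n => Set.Icc_subset_Icc le_rfl (by linarith [hle n]))
      (fun n => Set.Icc_subset_Icc hs.1 (by linarith [hle0 n, hv.2]))
    have A2 := gtb_side T κ q hκ hq g hg hc C hC hd hi v (v - s) hd0 (fun n => v - (v - s) / 2 ^ n)
      (fun n => ⟨by linarith [hps n], by linarith [hps n]⟩)
      (fun n => Set.Icc_subset_Icc (by linarith [hle n]) (by linarith))
      (fun n => Set.Icc_subset_Icc (by linarith [hle0 n, hs.1]) (by linarith [hv.2]))
    rw [← hU] at A1 A2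
    have e1 : s + (v - s) = v := by ring
    have e2 : v - (v - s) / 2 ^ 0 = s := by simp
    simp only [e1, e2] at A1 A2
    have hsub : Set.Icc s v ⊆ Set.Icc 0 T := Set.Icc_subset_Icc hs.1 hv.2
    have hcs : ∀ w ∈ Set.Icc (0:ℝ) T, IntegrableOn (fun t => ‖g w t‖) (Set.Icc s v) := by
      intro w hw
      have : ContinuousOn (fun t => g w t) (Set.Icc s v) :=
        hc.comp (f := fun t => (w, t)) (by fun_prop) (fun t ht => ⟨hw, hsub ht⟩)
      exact this.norm.integrableOn_compact isCompact_Icc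
    have ic : ∀ c : ℝ, IntegrableOn (fun _ : ℝ => c) (Set.Icc s v) := fun c =>
      continuousOn_const.integrableOn_compact isCompact_Icc
    have hmono : ∫ t in Set.Icc s v, ‖g s v‖ ≤
        ∫ t in Set.Icc s v, (‖g s t‖ + ‖g v t‖ + C * |v - s| ^ κ) := by
      refine setIntegral_mono_on (ic _) (((hcs s hs).add (hcs v hv)).add (ic _))
        measurableSet_Icc fun t ht => ?_
      have e1 := hd s hs t (hsub ht) v hv
      have e4 : g s v = (g s v - g s t - g t v) + g s t + g t v := by abel
      have e5 : ‖g s v‖ ≤ ‖g s v - g s t - g t v‖ + ‖g s t‖ + ‖g t v‖ := by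
        conv_lhs => rw [e4]
        exact norm_add₃_le
      rw [hanti t (hsub ht) v hv] at e5
      linarith
    have i23 : IntegrableOn (fun t => ‖g s t‖ + ‖g v t‖) (Set.Icc s v) := (hcs s hs).add (hcs v hv)
    rw [integral_add i23 (ic _), integral_add (hcs s hs) (hcs v hv),
      setIntegral_const, setIntegral_const, Real.volume_real_Icc, max_eq_left hd0.le,
      smul_eq_mul, smul_eq_mul] at hmono
    rw [abs_of_pos hd0] at hmono ⊢
    have hD : 0 ≤ (v - s) ^ κ := by positivity
    have h3 : (v - s) * ‖g s v‖ ≤ (v - s) * (2 * ((2 * U + C) * (v - s) ^ κ / (1 - (1/2) ^ κ))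
        + C * (v - s) ^ κ) := by linarith
    have h4 := le_of_mul_le_mul_left h3 hd0
    refine h4.trans ?_
    have h5 : (4 / (1 - (1/2) ^ κ) + 1) * (U + C) * (v - s) ^ κ -
      (2 * ((2 * U + C) * (v - s) ^ κ / (1 - (1/2) ^ κ)) + C * (v - s) ^ κ) =
      2 * C * (v - s) ^ κ / (1 - (1/2) ^ κ) + U * (v - s) ^ κ := by
      field_simp
      ring
    have h6 : 0 ≤ 2 * C * (v - s) ^ κ / (1 - (1/2) ^ κ) + U * (v - s) ^ κ := by positivity
    linarith
  intro s hs v hv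
  rcases lt_trichotomy s v with h | h | h
  · exact main s hs v hv h
  · subst h
    rw [hg, norm_zero]
    positivity
  · rw [hanti s hs v hv, abs_sub_comm]
    exact main v hv s hs h
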